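/- Embedding lemma: let B, B' be Boolean algebras and e : B → B' an injective Boolean algebra homomorphism. Then for every homomorphism H : Fm → 𝒫B with principal variables there exists a homomorphism H' : Fm → 𝒫B' with principal variables such that for every PT⁺ formula φ and every b ∈ B: b ∈ H(φ) if and only if e(b) ∈ H'(φ). -/

import Mathlib

/-- LT formulas: term algebra over variables with external connectives
`⊥, ¬, ∨, ∧` and internal connectives `i⊥, i¬, i∨, i∧`. -/
inductive Fm where
  | var  : ℕ → Fm
  | ebot : Fm
  | enot : Fm → Fm
  | eor  : Fm → Fm → Fm
  | eand : Fm → Fm → Fm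
  | ibot : Fm
  | inot : Fm → Fm
  | ior  : Fm → Fm → Fm
  | iand : Fm → Fm → Fm

/-- `H : Fm → Set B` is a homomorphism into the powerset algebra `𝒫 B`. -/
structure IsHom {B : Type} [BooleanAlgebra B] (H : Fm → Set B) : Prop where
  ebot : H .ebot = ∅
  enot : ∀ φ, H (.enot φ) = (H φ)ᶜ
  eor  : ∀ φ ψ, H (.eor φ ψ) = H φ ∪ H ψ
  eand : ∀ φ ψ, H (.eand φ ψ) = H φ ∩ H ψ
  ibot : H .ibot = {(⊥ : B)}
  inot : ∀ φ, H (.inot φ) = (fun a => aᶜ) '' H φ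
  ior  : ∀ φ ψ, H (.ior φ ψ) = Set.image2 (· ⊔ ·) (H φ) (H ψ)
  iand : ∀ φ ψ, H (.iand φ ψ) = Set.image2 (· ⊓ ·) (H φ) (H ψ)

/-- Entailment in LT. -/
def Entails (Δ : Set Fm) (ψ : Fm) : Prop :=
  ∀ (B : Type) [BooleanAlgebra B] (H : Fm → Set B),
    IsHom H → (⋂ φ ∈ Δ, H φ) ⊆ H ψ

/-- Labels: classical propositional formulas. -/
inductive Lb where
  | var : ℕ → Lb
  | bot : Lb
  | not : Lb → Lb
  | or  : Lb → Lb → Lb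
  | and : Lb → Lb → Lb

/-- `h : Lb → B` is a label homomorphism (Boolean evaluation). -/
structure IsLbHom {B : Type} [BooleanAlgebra B] (h : Lb → B) : Prop where
  bot : h .bot = ⊥
  not : ∀ a, h (.not a) = (h a)ᶜ
  or  : ∀ a b, h (.or a b) = h a ⊔ h b
  and : ∀ a b, h (.and a b) = h a ⊓ h b

/-- Atomic labels occurring in a label. -/
def Lb.atoms : Lb → Set ℕ
  | var i => {i}
  | bot => ∅
  | not a => a.atoms
  | or a b => a.atoms ∪ b.atoms
  | and a b => a.atoms ∪ b.atoms

/-- Two-valued (classical) evaluation of labels, for the tautology side condition. -/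
def Lb.evalBool (v : ℕ → Bool) : Lb → Bool
  | var i => v i
  | bot => false
  | not a => !(a.evalBool v)
  | or a b => a.evalBool v || b.evalBool v
  | and a b => a.evalBool v && b.evalBool v

/-- The internal top `i⊤ = i¬ i⊥`. -/
def Fm.itop : Fm := .inot .ibot

/-- The labelled formula `a = b`, i.e. `(a∨¬b)∧(¬a∨b) : i⊤`. -/
def lbEq (a b : Lb) : Lb × Fm :=
  (Lb.and (Lb.or a (Lb.not b)) (Lb.or (Lb.not a) b), Fm.itop)

/-- The labelled natural deduction system for LT. -/
inductive Proves : Set (Lb × Fm) → Lb × Fm → Prop where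
  | hyp {Γ c} : c ∈ Γ → Proves Γ c
  | eandI {Γ a φ ψ} : Proves Γ (a, φ) → Proves Γ (a, ψ) →
      Proves Γ (a, Fm.eand φ ψ)
  | eandE1 {Γ a φ ψ} : Proves Γ (a, Fm.eand φ ψ) → Proves Γ (a, φ)
  | eandE2 {Γ a φ ψ} : Proves Γ (a, Fm.eand φ ψ) → Proves Γ (a, ψ)
  | eorI1 {Γ a φ ψ} : Proves Γ (a, φ) → Proves Γ (a, Fm.eor φ ψ)
  | eorI2 {Γ a φ ψ} : Proves Γ (a, ψ) → Proves Γ (a, Fm.eor φ ψ)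
  | eorE {Γ a b φ ψ σ} : Proves Γ (a, Fm.eor φ ψ) →
      Proves (insert (a, φ) Γ) (b, σ) → Proves (insert (a, ψ) Γ) (b, σ) →
      Proves Γ (b, σ)
  | enotI {Γ a b φ} : Proves (insert (a, φ) Γ) (b, Fm.ebot) →
      Proves Γ (a, Fm.enot φ)
  | enotE {Γ a φ} : Proves Γ (a, φ) → Proves Γ (a, Fm.enot φ) →
      Proves Γ (a, Fm.ebot)
  | raa {Γ a b φ} : Proves (insert (a, Fm.enot φ) Γ) (b, Fm.ebot) →
      Proves Γ (a, φ)
  | botE {Γ a b φ} : Proves Γ (a, Fm.ebot) → Proves Γ (b, φ)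
  | iandI {Γ a b φ ψ} : Proves Γ (a, φ) → Proves Γ (b, ψ) →
      Proves Γ (Lb.and a b, Fm.iand φ ψ)
  | iandE {Γ} {a b : Lb} {p q : ℕ} {φ ψ σ : Fm} :
      p ≠ q →
      (∀ r ∈ Γ, p ∉ (Prod.fst r).atoms ∧ q ∉ (Prod.fst r).atoms) →
      p ∉ a.atoms → q ∉ a.atoms → p ∉ b.atoms → q ∉ b.atoms →
      Proves Γ (a, Fm.iand φ ψ) →
      Proves (insert (Lb.var p, φ) (insert (Lb.var q, ψ)
        (insert (lbEq a (Lb.and (Lb.var p) (Lb.var q))) Γ))) (b, σ) →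
      Proves Γ (b, σ)
  | iorI {Γ a b φ ψ} : Proves Γ (a, φ) → Proves Γ (b, ψ) →
      Proves Γ (Lb.or a b, Fm.ior φ ψ)
  | iorE {Γ} {a b : Lb} {p q : ℕ} {φ ψ σ : Fm} :
      p ≠ q →
      (∀ r ∈ Γ, p ∉ (Prod.fst r).atoms ∧ q ∉ (Prod.fst r).atoms) →
      p ∉ a.atoms → q ∉ a.atoms → p ∉ b.atoms → q ∉ b.atoms →
      Proves Γ (a, Fm.ior φ ψ) →
      Proves (insert (Lb.var p, φ) (insert (Lb.var q, ψ)
        (insert (lbEq a (Lb.or (Lb.var p) (Lb.var q))) Γ))) (b, σ) →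
      Proves Γ (b, σ)
  | inotI {Γ a φ} : Proves Γ (a, φ) → Proves Γ (Lb.not a, Fm.inot φ)
  | inotE {Γ a φ} : Proves Γ (a, Fm.inot φ) → Proves Γ (Lb.not a, φ)
  | taut {Γ b} (L : List Lb) :
      (∀ a ∈ L, Proves Γ (a, Fm.itop)) →
      (∀ v : ℕ → Bool, (∀ a ∈ L, a.evalBool v = true) → b.evalBool v = true) →
      Proves Γ (b, Fm.itop)
  | sub {Γ a b φ} : Proves Γ (lbEq a b) → Proves Γ (b, φ) → Proves Γ (a, φ)

/-- Semantic entailment for labelled formulas. -/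
def LEntails (Γ : Set (Lb × Fm)) (c : Lb × Fm) : Prop :=
  ∀ (B : Type) [BooleanAlgebra B] (h : Lb → B) (H : Fm → Set B),
    IsLbHom h → IsHom H →
    (∀ r ∈ Γ, h r.1 ∈ H r.2) → h c.1 ∈ H c.2

/-- Consistency of a set of labelled formulas. -/
def Consistent (Γ : Set (Lb × Fm)) : Prop := ¬ Proves Γ (Lb.bot, Fm.ebot)

/-- Strict negation on subsets of a Boolean algebra. -/
def sNeg {B : Type} [BooleanAlgebra B] (A : Set B) : Set B :=
  {b | ∀ a ∈ A, b ⊓ a = ⊥}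

/-- Strict negation as a defined LT connective:
`∼φ = ¬(((φ i∧ ¬⊥) ∧ ¬ i⊥) i∨ ¬⊥)`. -/
def Fm.snot (φ : Fm) : Fm :=
  .enot (.ior (.eand (.iand φ (.enot .ebot)) (.enot .ibot)) (.enot .ebot))

/-- The possibility operator `◇φ := (φ i∧ ¬⊥) i∨ ¬⊥`. -/
def Fm.diam (φ : Fm) : Fm := .ior (.iand φ (.enot .ebot)) (.enot .ebot)

/-- The necessity operator `□φ := ¬◇¬φ`. -/
def Fm.box (φ : Fm) : Fm := .enot (Fm.diam (.enot φ))

/-- The evaluation homomorphism determined by a variable assignment. -/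
def Fm.eval {B : Type} [BooleanAlgebra B] (v : ℕ → Set B) : Fm → Set B
  | .var i => v i
  | .ebot => ∅
  | .enot φ => (φ.eval v)ᶜ
  | .eor φ ψ => φ.eval v ∪ ψ.eval v
  | .eand φ ψ => φ.eval v ∩ ψ.eval v
  | .ibot => {⊥}
  | .inot φ => (fun a => aᶜ) '' φ.eval v
  | .ior φ ψ => Set.image2 (· ⊔ ·) (φ.eval v) (ψ.eval v)
  | .iand φ ψ => Set.image2 (· ⊓ ·) (φ.eval v) (ψ.eval v)

/-- A homomorphism has principal variables if every variable is sent to a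
(non-empty) principal ideal. -/
def PrincipalVars {B : Type} [BooleanAlgebra B] (H : Fm → Set B) : Prop :=
  ∀ i, ∃ b : B, H (.var i) = {a | a ≤ b}

/-- PT⁺ formulas. -/
inductive PTFm where
  | var     : ℕ → PTFm
  | snotVar : ℕ → PTFm
  | ibot    : PTFm
  | nb      : PTFm
  | ior     : PTFm → PTFm → PTFm
  | eand    : PTFm → PTFm → PTFm
  | eor     : PTFm → PTFm → PTFm

/-- PT⁺ formulas as LT formulas. -/
def PTFm.toFm : PTFm → Fm
  | .var i => .var i
  | .snotVar i => Fm.snot (.var i)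
  | .ibot => .ibot
  | .nb => .enot .ibot
  | .ior φ ψ => .ior φ.toFm ψ.toFm
  | .eand φ ψ => .eand φ.toFm ψ.toFm
  | .eor φ ψ => .eor φ.toFm ψ.toFm

/-- Valuational team-semantic denotations of PT⁺ formulas. -/
def PTFm.den : PTFm → Set (Set (ℕ → Bool))
  | .var i => {X | ∀ s ∈ X, s i = true}
  | .snotVar i => {X | ∀ s ∈ X, s i = false}
  | .ibot => {∅}
  | .nb => {X | X ≠ ∅}
  | .ior φ ψ => Set.image2 (· ∪ ·) φ.den ψ.den
  | .eand φ ψ => φ.den ∩ ψ.den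
  | .eor φ ψ => φ.den ∪ ψ.den

/-- PT⁺ entailment. -/
def PTEntails (Δ : Set PTFm) (φ : PTFm) : Prop :=
  (⋂ δ ∈ Δ, PTFm.den δ) ⊆ PTFm.den φ

/-- The valuation homomorphism `H_V : Fm → 𝒫(𝒫(2^ℕ))`. -/
def HV : Fm → Set (Set (ℕ → Bool)) :=
  Fm.eval (fun i => {X : Set (ℕ → Bool) | ∀ s ∈ X, s i = true})

/-- The principal variable axioms. -/
def PVA : Set Fm :=
  Set.range (fun i => Fm.box (Fm.ior (Fm.var i) (Fm.snot (Fm.var i))))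

/-- A substitution: an algebra endomorphism of the term algebra of formulas. -/
structure IsSubst (σ : Fm → Fm) : Prop where
  ebot : σ .ebot = .ebot
  enot : ∀ φ, σ (.enot φ) = .enot (σ φ)
  eor  : ∀ φ ψ, σ (.eor φ ψ) = .eor (σ φ) (σ ψ)
  eand : ∀ φ ψ, σ (.eand φ ψ) = .eand (σ φ) (σ ψ)
  ibot : σ .ibot = .ibot
  inot : ∀ φ, σ (.inot φ) = .inot (σ φ)
  ior  : ∀ φ ψ, σ (.ior φ ψ) = .ior (σ φ) (σ ψ)
  iand : ∀ φ ψ, σ (.iand φ ψ) = .iand (σ φ) (σ ψ)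

/-- A bundled homomorphism into the powerset of a Boolean algebra. -/
structure LTHom where
  carrier : Type
  inst : BooleanAlgebra carrier
  H : Fm → Set carrier
  isHom : @IsHom carrier inst H

/-- Local entailment of a single homomorphism. -/
def LTHom.localEntails (h : LTHom) (Δ : Set Fm) (φ : Fm) : Prop :=
  (⋂ δ ∈ Δ, h.H δ) ⊆ h.H φ

/-- Entailment relative to a class of homomorphisms. -/
def ClassEntails (C : Set LTHom) (Δ : Set Fm) (φ : Fm) : Prop :=
  ∀ h ∈ C, h.localEntails Δ φ

/-- The class `C` of homomorphisms is definable by the set `Ax` of formulas. -/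
def DefinableBy (C : Set LTHom) (Ax : Set Fm) : Prop :=
  ∀ h : LTHom, h ∈ C ↔ ∀ π ∈ Ax, h.H π = Set.univ

theorem Fm.isHom_eval {B : Type} [BooleanAlgebra B] (v : ℕ → Set B) : IsHom (Fm.eval v) :=
  ⟨rfl, fun _ => rfl, fun _ _ => rfl, fun _ _ => rfl, rfl, fun _ => rfl, fun _ _ => rfl,
    fun _ _ => rfl⟩

/-- On a principal ideal, strict negation is the principal ideal of the complement. -/
theorem IsHom.mem_snot_var {B : Type} [BooleanAlgebra B] {H : Fm → Set B} (hH : IsHom H)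
    {i : ℕ} {p : B} (hp : H (.var i) = {a | a ≤ p}) (b : B) :
    b ∈ H (Fm.snot (.var i)) ↔ b ≤ pᶜ := by
  simp only [Fm.snot, hH.enot, hH.ior, hH.eand, hH.iand, hH.ibot, hH.ebot, hp]
  rw [Set.mem_compl_iff, ← not_iff_not, not_not]
  constructor
  · rintro ⟨_, ⟨⟨x, hx, y, -, rfl⟩, hne⟩, z, -, rfl⟩ hle
    refine hne (le_bot_iff.mp ?_)
    rw [← inf_compl_eq_bot (a := p)]
    exact le_inf (inf_le_left.trans hx) (le_sup_left.trans hle)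
  · intro hle
    refine ⟨p ⊓ b, ⟨⟨p, le_refl p, b, by simp, rfl⟩, fun h => hle ?_⟩, b, by simp, by simp⟩
    rw [le_compl_iff_disjoint_left, disjoint_iff]
    exact h

/-- A strict bound on the indices of the variables occurring in a formula. -/
def PTFm.varBound : PTFm → ℕ
  | .var i => i + 1
  | .snotVar i => i + 1
  | .ibot => 0
  | .nb => 0
  | .ior φ ψ => max φ.varBound ψ.varBound
  | .eand φ ψ => max φ.varBound ψ.varBound
  | .eor φ ψ => max φ.varBound ψ.varBound

/-- A join-preserving closure-like operator on `C` under which the principal ideals of `p i` and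
`(p i)ᶜ` are stable for `i < n`. -/
structure IsHull {C : Type} [BooleanAlgebra C] (p : ℕ → C) (n : ℕ) (h : C → C) : Prop where
  map_bot : h ⊥ = ⊥
  map_sup : ∀ x y, h (x ⊔ y) = h x ⊔ h y
  le_hull : ∀ x, x ≤ h x
  hull_le : ∀ i < n, ∀ x, x ≤ p i → h x ≤ p i
  hull_le_compl : ∀ i < n, ∀ x, x ≤ (p i)ᶜ → h x ≤ (p i)ᶜ

/-- The hull of `x` is the join of those cells of the finite partition generated by the `f (q i)`,
`i < n`, which meet `x`; it lies in the range of `f`. -/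
theorem exists_isHull {B C : Type} [BooleanAlgebra B] [BooleanAlgebra C]
    (f : BoundedLatticeHom B C) (q : ℕ → B) (n : ℕ) :
    ∃ h : C → C, IsHull (fun i => f (q i)) n h ∧ ∀ x, ∃ b, f b = h x := by
  classical
  induction n with
  | zero =>
    refine ⟨fun x => if x = ⊥ then ⊥ else ⊤, ⟨by simp, fun x y => ?_, fun x => ?_, by simp,
      by simp⟩, fun x => ?_⟩
    · by_cases hx : x = ⊥ <;> by_cases hy : y = ⊥ <;> simp [hx, hy]
    · by_cases hx : x = ⊥ <;> simp [hx]
    · by_cases hx : x = ⊥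
      · exact ⟨⊥, by simp [hx]⟩
      · exact ⟨⊤, by simp [hx]⟩
  | succ n ih =>
    obtain ⟨h, hh, hr⟩ := ih
    have mono : Monotone h := fun x y hxy => by
      rw [← sup_eq_right.mpr hxy, hh.map_sup]
      exact le_sup_left
    have le_of_stable (u : C) (hu : ∀ x, x ≤ u → h x ≤ u) (x : C) (hx : x ≤ u) :
        (f (q n) ⊓ h (x ⊓ f (q n))) ⊔ ((f (q n))ᶜ ⊓ h (x ⊓ (f (q n))ᶜ)) ≤ u :=
      sup_le (inf_le_right.trans (hu _ (inf_le_left.trans hx)))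
        (inf_le_right.trans (hu _ (inf_le_left.trans hx)))
    refine ⟨fun x => (f (q n) ⊓ h (x ⊓ f (q n))) ⊔ ((f (q n))ᶜ ⊓ h (x ⊓ (f (q n))ᶜ)),
      ⟨by simp [hh.map_bot], fun x y => ?_, fun x => ?_, fun i hi x hx => ?_,
        fun i hi x hx => ?_⟩, fun x => ?_⟩
    · simp only [inf_sup_right, hh.map_sup, inf_sup_left]
      exact sup_sup_sup_comm _ _ _ _
    · calc x = (x ⊓ f (q n)) ⊔ (x ⊓ (f (q n))ᶜ) := sup_inf_inf_compl.symm
        _ ≤ _ := sup_le_sup (le_inf inf_le_right (hh.le_hull _))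
          (le_inf inf_le_right (hh.le_hull _))
    · rcases Nat.lt_succ_iff_lt_or_eq.mp hi with hi | rfl
      · exact le_of_stable _ (hh.hull_le i hi) x hx
      · have hx' : x ⊓ (f (q i))ᶜ = ⊥ :=
          disjoint_iff.mp (disjoint_compl_right.mono_left hx)
        simp [hx', hh.map_bot]
    · rcases Nat.lt_succ_iff_lt_or_eq.mp hi with hi | rfl
      · exact le_of_stable _ (hh.hull_le_compl i hi) x hx
      · have hx' : x ⊓ f (q i) = ⊥ :=
          disjoint_iff.mp (disjoint_compl_left.mono_left hx)
        simp [hx', hh.map_bot]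
    · obtain ⟨b, hb⟩ := hr (x ⊓ f (q n))
      obtain ⟨c, hc⟩ := hr (x ⊓ (f (q n))ᶜ)
      exact ⟨(q n ⊓ b) ⊔ ((q n)ᶜ ⊓ c), by simp [hb, hc]⟩

/-- The denotation of a PT⁺ formula is stable under enlarging an element within its hull. -/
theorem IsHull.mem_of_le {C : Type} [BooleanAlgebra C] {H : Fm → Set C} (hH : IsHom H)
    {p : ℕ → C} (hp : ∀ i, H (.var i) = {a | a ≤ p i}) {n : ℕ} {h : C → C} (hh : IsHull p n h)
    (φ : PTFm) (hφ : φ.varBound ≤ n) {x y : C} (hx : x ∈ H φ.toFm) (hxy : x ≤ y)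
    (hy : y ≤ h x) : y ∈ H φ.toFm := by
  induction φ generalizing x y with
  | var i =>
    simp only [PTFm.toFm, hp, Set.mem_ofPred_eq] at hx ⊢
    exact hy.trans (hh.hull_le i hφ x hx)
  | snotVar i =>
    simp only [PTFm.toFm, hH.mem_snot_var (hp i)] at hx ⊢
    exact hy.trans (hh.hull_le_compl i hφ x hx)
  | ibot =>
    simp only [PTFm.toFm, hH.ibot, Set.mem_singleton_iff] at hx ⊢
    subst hx
    exact le_bot_iff.mp (hh.map_bot ▸ hy)
  | nb =>
    simp only [PTFm.toFm, hH.enot, hH.ibot, Set.mem_compl_iff, Set.mem_singleton_iff] at hx ⊢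
    rintro rfl
    exact hx (le_bot_iff.mp hxy)
  | ior φ ψ ihφ ihψ =>
    simp only [PTFm.varBound, max_le_iff] at hφ
    simp only [PTFm.toFm, hH.ior] at hx ⊢
    obtain ⟨c, hc, d, hd, rfl⟩ := hx
    refine ⟨y ⊓ h c, ihφ hφ.1 hc (le_inf (le_sup_left.trans hxy) (hh.le_hull c)) inf_le_right,
      y ⊓ h d, ihψ hφ.2 hd (le_inf (le_sup_right.trans hxy) (hh.le_hull d)) inf_le_right, ?_⟩
    simp only [← inf_sup_left, ← hh.map_sup]
    exact inf_eq_left.mpr hy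
  | eand φ ψ ihφ ihψ =>
    simp only [PTFm.varBound, max_le_iff] at hφ
    simp only [PTFm.toFm, hH.eand] at hx ⊢
    exact ⟨ihφ hφ.1 hx.1 hxy hy, ihψ hφ.2 hx.2 hxy hy⟩
  | eor φ ψ ihφ ihψ =>
    simp only [PTFm.varBound, max_le_iff] at hφ
    simp only [PTFm.toFm, hH.eor] at hx ⊢
    exact hx.imp (fun hx => ihφ hφ.1 hx hxy hy) (fun hx => ihψ hφ.2 hx hxy hy)

theorem PTFm.mem_iff_map_mem {B C : Type} [BooleanAlgebra B] [BooleanAlgebra C]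
    (f : BoundedLatticeHom B C) (hf : Function.Injective f) {H : Fm → Set B} {H' : Fm → Set C}
    (hH : IsHom H) (hH' : IsHom H') {q : ℕ → B} (hq : ∀ i, H (.var i) = {a | a ≤ q i})
    (hq' : ∀ i, H' (.var i) = {a | a ≤ f (q i)}) (φ : PTFm) (b : B) :
    b ∈ H φ.toFm ↔ f b ∈ H' φ.toFm := by
  have le_iff (x y : B) : f x ≤ f y ↔ x ≤ y := by
    rw [← inf_eq_left, ← map_inf, hf.eq_iff, inf_eq_left]
  have eq_bot_iff (x : B) : f x = ⊥ ↔ x = ⊥ := by rw [← map_bot f, hf.eq_iff]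
  induction φ generalizing b with
  | var i => simp [PTFm.toFm, hq, hq', le_iff]
  | snotVar i =>
    simp only [PTFm.toFm, hH.mem_snot_var (hq i), hH'.mem_snot_var (hq' i)]
    rw [← map_compl', le_iff]
  | ibot => simp [PTFm.toFm, hH.ibot, hH'.ibot, eq_bot_iff]
  | nb => simp [PTFm.toFm, hH.ibot, hH'.ibot, hH.enot, hH'.enot, eq_bot_iff]
  | ior φ ψ ihφ ihψ =>
    simp only [PTFm.toFm, hH.ior, hH'.ior]
    constructor
    · rintro ⟨c, hc, d, hd, rfl⟩
      exact ⟨f c, (ihφ c).mp hc, f d, (ihψ d).mp hd, (map_sup f c d).symm⟩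
    · rintro ⟨c', hc, d', hd, hcd : c' ⊔ d' = f b⟩
      obtain ⟨h, hh, hr⟩ := exists_isHull f q (max φ.varBound ψ.varBound)
      obtain ⟨c, hc'⟩ := hr c'
      obtain ⟨d, hd'⟩ := hr d'
      refine ⟨b ⊓ c, (ihφ _).mpr ?_, b ⊓ d, (ihψ _).mpr ?_, hf ?_⟩
      · rw [map_inf, hc', ← hcd]
        exact hh.mem_of_le hH' hq' φ (le_max_left _ _) hc (le_inf le_sup_left (hh.le_hull _))
          inf_le_right
      · rw [map_inf, hd', ← hcd]
        exact hh.mem_of_le hH' hq' ψ (le_max_right _ _) hd (le_inf le_sup_right (hh.le_hull _))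
          inf_le_right
      · simp only [map_sup, map_inf, hc', hd', ← inf_sup_left, ← hh.map_sup, hcd]
        exact inf_eq_left.mpr (hh.le_hull _)
  | eand φ ψ ihφ ihψ => simp [PTFm.toFm, hH.eand, hH'.eand, ihφ, ihψ]
  | eor φ ψ ihφ ihψ => simp [PTFm.toFm, hH.eor, hH'.eor, ihφ, ihψ]

/-- Embedding lemma. -/
theorem embedding_lemma (B B' : Type) [BooleanAlgebra B] [BooleanAlgebra B']
    (e : B → B') (hinj : Function.Injective e)
    (hbot : e ⊥ = ⊥) (htop : e ⊤ = ⊤)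
    (hsup : ∀ x y, e (x ⊔ y) = e x ⊔ e y)
    (hinf : ∀ x y, e (x ⊓ y) = e x ⊓ e y)
    (hcompl : ∀ x, e xᶜ = (e x)ᶜ)
    (H : Fm → Set B) (hH : IsHom H) (hpv : PrincipalVars H) :
    ∃ H' : Fm → Set B', IsHom H' ∧ PrincipalVars H' ∧
      ∀ (φ : PTFm) (b : B), b ∈ H φ.toFm ↔ e b ∈ H' φ.toFm := by
  choose q hq using hpv
  let f : BoundedLatticeHom B B' :=
    { toFun := e, map_sup' := hsup, map_inf' := hinf, map_top' := htop, map_bot' := hbot }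
  have hH' := Fm.isHom_eval fun i => {a | a ≤ f (q i)}
  exact ⟨_, hH', fun i => ⟨f (q i), rfl⟩,
    PTFm.mem_iff_map_mem f hinj hH hH' hq fun _ => rfl⟩
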